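/- With the discrete variational setup below, let K ⊆ F be a finite set of facets and let y : Π v : V, E v be a discrete field such that each L_β (β ∈ F) is everywhere Fréchet-differentiable. Suppose y is critical for fixed boundary variations, i.e., for every δ : Π v : V, E v with δ v = 0 for every vertex v that is not interior to K, the real function t ↦ 𝕃_K(y + t·δ) has derivative 0 at t = 0. Then for every vertex v interior to K the discrete Euler–Lagrange equation holds: Σ_{β ∈ Star v} ∂^{(v,β)}L_β(jyβ) = 0 in E v →L[ℝ] ℝ (note Star v ⊆ K is finite, so the sum is finite). -/

import Mathlib

open scoped Classical

/-- The continuous linear inclusion of `E (β k)` as the `k`-th coordinate of `Π k, E (β k)`. -/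
noncomputable def coordIncl {V : Type*} {n : ℕ} (E : V → Type*)
    [∀ v, NormedAddCommGroup (E v)] [∀ v, NormedSpace ℝ (E v)]
    (β : Fin (n + 1) → V) (k : Fin (n + 1)) :
    E (β k) →L[ℝ] (∀ j, E (β j)) :=
  ContinuousLinearMap.pi (Pi.single k (ContinuousLinearMap.id ℝ (E (β k))))

/-- The partial derivative `∂^{(v,β)} L (z) : E v →L[ℝ] ℝ` of a discrete Lagrangian `L` on
the facet `β` at the vertex `v`: the Fréchet derivative of `L` at `z` composed with the
inclusion of the coordinate corresponding to `v` (and `0` if `v` is not a vertex of `β`). -/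
noncomputable def dpart {V : Type*} {n : ℕ} (E : V → Type*)
    [∀ v, NormedAddCommGroup (E v)] [∀ v, NormedSpace ℝ (E v)]
    (β : Fin (n + 1) → V) (L : (∀ k, E (β k)) → ℝ) (z : ∀ k, E (β k)) (v : V) :
    E v →L[ℝ] ℝ :=
  if h : v ∈ Set.range β then
    h.choose_spec ▸ ((fderiv ℝ L z).comp (coordIncl E β h.choose))
  else 0

/-- The inclusion of the `k`-th coordinate is the jet of the discrete field supported at `β k`. -/
theorem coordIncl_apply {V : Type*} {n : ℕ} (E : V → Type*)
    [∀ v, NormedAddCommGroup (E v)] [∀ v, NormedSpace ℝ (E v)]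
    {β : Fin (n + 1) → V} (hβ : Function.Injective β) (k : Fin (n + 1)) (w : E (β k)) :
    coordIncl E β k w = fun j => Pi.single (β k) w (β j) := by
  funext j
  by_cases h : j = k
  · subst h
    simp [coordIncl]
  · simp [coordIncl, Pi.single_eq_of_ne h, Pi.single_eq_of_ne (hβ.ne h)]

/-- The partial derivative at a vertex of a facet is the derivative in the direction of the jet
of the discrete field supported at that vertex. -/
theorem dpart_apply {V : Type*} {n : ℕ} (E : V → Type*)
    [∀ v, NormedAddCommGroup (E v)] [∀ v, NormedSpace ℝ (E v)]
    {β : Fin (n + 1) → V} (hβ : Function.Injective β) (L : (∀ k, E (β k)) → ℝ)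
    (z : ∀ k, E (β k)) {v : V} (hv : v ∈ Set.range β) (w : E v) :
    dpart E β L z v w = fderiv ℝ L z (fun k => Pi.single v w (β k)) := by
  have transport : ∀ (k : Fin (n + 1)) (u : V) (h : β k = u) (w : E u),
      (h ▸ (fderiv ℝ L z).comp (coordIncl E β k) : E u →L[ℝ] ℝ) w =
        fderiv ℝ L z (fun j => Pi.single u w (β j)) := by
    rintro k _ rfl w
    exact congrArg (fderiv ℝ L z) (coordIncl_apply E hβ k w)
  rw [dpart, dif_pos hv]
  exact transport _ _ _ w

/-- A discrete field that is critical for the discrete action `𝕃_K` with respect to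
variations vanishing at all non-interior vertices satisfies, at every interior vertex `v`
of `K`, the discrete Euler–Lagrange equation `∑_{β ∈ Star v} ∂^{(v,β)} L_β (jyβ) = 0`. -/
theorem discrete_eulerLagrange_of_critical {V : Type*} {n : ℕ}
    (F : Set (Fin (n + 1) → V)) (hF : ∀ β ∈ F, Function.Injective β)
    (E : V → Type*) [∀ v, NormedAddCommGroup (E v)] [∀ v, NormedSpace ℝ (E v)]
    (L : ∀ β : Fin (n + 1) → V, (∀ k, E (β k)) → ℝ)
    (K : Set (Fin (n + 1) → V)) (hKF : K ⊆ F) (hK : K.Finite)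
    (y : ∀ v, E v)
    (hdiff : ∀ β ∈ F, Differentiable ℝ (L β))
    (hcrit : ∀ δ : ∀ v, E v,
      (∀ v : V, ¬ ({β ∈ F | v ∈ Set.range β} ⊆ K) → δ v = 0) →
      HasDerivAt
        (fun t : ℝ => ∑ᶠ β ∈ K, L β (fun k => y (β k) + t • δ (β k))) 0 0)
    (v : V) (hv : {β ∈ F | v ∈ Set.range β} ⊆ K) :
    ∑ᶠ β ∈ {β ∈ F | v ∈ Set.range β}, dpart E β (L β) (fun k => y (β k)) v = 0 := by
  have hstar := hK.subset hv
  ext w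
  set δ : ∀ u, E u := Pi.single v w
  have hderiv := hcrit δ fun u hu => Pi.single_eq_of_ne (by rintro rfl; exact hu hv) w
  have hjet : ∀ β ∈ hK.toFinset,
      HasDerivAt (fun t : ℝ => L β (fun k => y (β k) + t • δ (β k)))
        (fderiv ℝ (L β) (fun k => y (β k)) (fun k => δ (β k))) 0 := by
    intro β hβ
    exact (hdiff β (hKF (hK.mem_toFinset.1 hβ)) _).hasFDerivAt.hasLineDerivAt
      (fun k => δ (β k))
  simp only [finsum_mem_eq_finite_toFinset_sum _ hK] at hderiv
  have hsum := (HasDerivAt.fun_sum hjet).unique hderiv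
  rw [finsum_mem_eq_finite_toFinset_sum _ hstar, sum_apply,
    zero_apply, ← hsum]
  have hsub : hstar.toFinset ⊆ hK.toFinset := Set.Finite.toFinset_subset_toFinset.2 hv
  rw [← Finset.sum_subset hsub]
  · refine Finset.sum_congr rfl fun β hβ => ?_
    obtain ⟨hβF, hvβ⟩ := hstar.mem_toFinset.1 hβ
    exact dpart_apply E (hF β hβF) (L β) _ hvβ w
  · intro β hβ hβv
    have hzero : (fun k => δ (β k)) = 0 := by
      funext k
      refine Pi.single_eq_of_ne (fun hk => hβv ?_) w
      exact hstar.mem_toFinset.2 ⟨hKF (hK.mem_toFinset.1 hβ), k, hk⟩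
    rw [hzero, map_zero]
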